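/- Let u be a bounded ancient mild solution of the Navier–Stokes equations in ℝⁿ×(−∞,0) of the form u(x,t) = b(t) for some function b : (−∞,0) → ℝⁿ. Then u is constant, i.e. b(t) is independent of t. -/

import Mathlib

open MeasureTheory Real Filter Topology

noncomputable section

/-- Euclidean space ℝⁿ. -/
abbrev Euc (n : ℕ) := EuclideanSpace ℝ (Fin n)

/-- The heat kernel Γ(x,t) = (4πt)^{-n/2} exp(-|x|²/(4t)). -/
noncomputable def heatKer (n : ℕ) (x : Euc n) (t : ℝ) : ℝ :=
  (4 * π * t) ^ (-(n : ℝ) / 2) * Real.exp (-‖x‖ ^ 2 / (4 * t))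

/-- The fundamental solution G of the Laplacian on ℝⁿ (n ≥ 2). -/
noncomputable def lapFund (n : ℕ) (x : Euc n) : ℝ :=
  if n = 2 then (2 * π)⁻¹ * Real.log ‖x‖
  else -((((n : ℝ) - 2) * (2 * π ^ ((n : ℝ) / 2) / Real.Gamma ((n : ℝ) / 2)))⁻¹) *
      ‖x‖ ^ (2 - (n : ℝ))

/-- The generating function Φ(x,t) = ∫_{ℝⁿ} G(y) Γ(x-y,t) dy. -/
noncomputable def genPhi (n : ℕ) (x : Euc n) (t : ℝ) : ℝ :=
  ∫ y : Euc n, lapFund n y * heatKer n (x - y) t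

/-- Spatial partial derivative ∂f/∂x_i of a scalar function on ℝⁿ. -/
noncomputable def pd (n : ℕ) (i : Fin n) (f : Euc n → ℝ) (x : Euc n) : ℝ :=
  fderiv ℝ f x (EuclideanSpace.single i 1)

/-- The Laplacian of a scalar function on ℝⁿ. -/
noncomputable def lap (n : ℕ) (f : Euc n → ℝ) (x : Euc n) : ℝ :=
  ∑ i : Fin n, pd n i (pd n i f) x

/-- The Oseen kernel K_{ij} = (-δ_{ij}Δ + ∂²/∂x_i∂x_j)Φ. -/
noncomputable def Kmat (n : ℕ) (i j : Fin n) (x : Euc n) (t : ℝ) : ℝ :=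
  (if i = j then -(lap n (fun y => genPhi n y t) x) else 0)
    + pd n i (pd n j (fun y => genPhi n y t)) x

/-- The kernel K_{ijk} = ∂K_{ij}/∂x_k. -/
noncomputable def Kten (n : ℕ) (i j k : Fin n) (x : Euc n) (t : ℝ) : ℝ :=
  pd n k (fun y => Kmat n i j y t) x

/-- Mild solution of the Navier–Stokes equations on ℝⁿ × (t₀,t₁) with initial datum u₀:
u_i(x,t) = ∫ Γ(x-y,t-t₀) u₀ᵢ(y) dy - ∫_{t₀}^t ∫ K_{ijk}(x-y,t-s) u_k u_j dy ds. -/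
def IsMildNS (n : ℕ) (t₀ t₁ : ℝ) (u₀ : Euc n → Euc n) (u : Euc n → ℝ → Euc n) : Prop :=
  ∀ x : Euc n, ∀ t : ℝ, t ∈ Set.Ioo t₀ t₁ → ∀ i : Fin n,
    u x t i = (∫ y : Euc n, heatKer n (x - y) (t - t₀) * u₀ y i)
      - ∫ s in Set.Ioo t₀ t, ∫ y : Euc n,
          ∑ j : Fin n, ∑ k : Fin n, Kten n i j k (x - y) (t - s) * u y s k * u y s j

/-- Spatial partial derivative for functions on space-time ℝⁿ × ℝ. -/
noncomputable def pdx (n : ℕ) (i : Fin n) (g : Euc n × ℝ → ℝ) (p : Euc n × ℝ) : ℝ :=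
  fderiv ℝ g p (EuclideanSpace.single i 1, 0)

/-- Time derivative for functions on space-time ℝⁿ × ℝ. -/
noncomputable def pdt (n : ℕ) (g : Euc n × ℝ → ℝ) (p : Euc n × ℝ) : ℝ :=
  fderiv ℝ g p (0, 1)

/-- Spatial Laplacian for functions on space-time ℝⁿ × ℝ. -/
noncomputable def lapx (n : ℕ) (g : Euc n × ℝ → ℝ) (p : Euc n × ℝ) : ℝ :=
  ∑ i : Fin n, pdx n i (pdx n i g) p

/-- An ancient mild solution of the Navier–Stokes equations: a bounded measurable
u : ℝⁿ × (-∞,0) → ℝⁿ for which there is a sequence T_l → -∞ such that u restricted to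
ℝⁿ × (T_l,0) is a mild solution with initial datum u(·,T_l). -/
def IsAncientMild (n : ℕ) (u : Euc n → ℝ → Euc n) : Prop :=
  Measurable (fun q : Euc n × ℝ => u q.1 q.2) ∧
  (∃ C : ℝ, ∀ x : Euc n, ∀ t < (0:ℝ), ‖u x t‖ ≤ C) ∧
  ∃ S : ℕ → ℝ, Filter.Tendsto S Filter.atTop Filter.atBot ∧
    ∀ l, S l < 0 ∧ IsMildNS n (S l) 0 (fun x => u x (S l)) u

lemma heatKer_neg (n : ℕ) (x : Euc n) (t : ℝ) : heatKer n (-x) t = heatKer n x t := by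
  simp [heatKer]

lemma lapFund_neg (n : ℕ) (x : Euc n) : lapFund n (-x) = lapFund n x := by
  simp [lapFund]

/-- The generating function is even in space. -/
lemma genPhi_neg (n : ℕ) (x : Euc n) (t : ℝ) : genPhi n (-x) t = genPhi n x t := by
  unfold genPhi
  rw [← integral_neg_eq_self]
  refine integral_congr_ae (Eventually.of_forall fun y => ?_)
  simp only [lapFund_neg]
  rw [show -x - -y = -(x - y) by abel, heatKer_neg]

/-- The partial derivative of a reflected function. -/
lemma pd_comp_neg {n : ℕ} (i : Fin n) (f : Euc n → ℝ) (x : Euc n) :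
    pd n i (fun y => f (-y)) x = -pd n i f (-x) := by
  have h := (ContinuousLinearEquiv.neg ℝ (M := Euc n)).comp_right_fderiv (f := f) (x := x)
  change fderiv ℝ (fun y => f (-y)) x = _ at h
  simp [pd, h]

/-- A partial derivative of an even function is odd. -/
lemma pd_odd_of_even {n : ℕ} (i : Fin n) {f : Euc n → ℝ} (hf : f.Even) : (pd n i f).Odd := by
  intro x
  have h := pd_comp_neg i f x
  rw [show (fun y => f (-y)) = f from funext hf] at h
  rw [h, neg_neg]

/-- A partial derivative of an odd function is even. -/
lemma pd_even_of_odd {n : ℕ} (i : Fin n) {f : Euc n → ℝ} (hf : f.Odd) : (pd n i f).Even := by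
  intro x
  have h := pd_comp_neg i f x
  rw [show (fun y => f (-y)) = fun y => -f y from funext hf] at h
  simpa [pd] using h.symm

lemma Kmat_even (n : ℕ) (i j : Fin n) (t : ℝ) : (fun x => Kmat n i j x t).Even := by
  have hd (k l : Fin n) : (pd n k (pd n l fun y => genPhi n y t)).Even :=
    pd_even_of_odd k (pd_odd_of_even l fun x => genPhi_neg n x t)
  intro x
  simp only [Kmat, lap, fun k l => hd k l x]

lemma Kten_odd (n : ℕ) (i j k : Fin n) (t : ℝ) : (fun x => Kten n i j k x t).Odd :=
  pd_odd_of_even k (Kmat_even n i j t)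

/-- The integral of an odd function over the whole space vanishes. -/
lemma Euc.integral_eq_zero_of_odd {n : ℕ} {f : Euc n → ℝ} (hf : f.Odd) : ∫ x, f x = 0 := by
  have h := integral_neg_eq_self f (volume : Measure (Euc n))
  rw [show (fun x => f (-x)) = fun x => -f x from funext hf, integral_neg] at h
  linarith

/-- The Oseen kernel term annihilates spatially constant tensors. -/
lemma integral_Kten_const (n : ℕ) (i : Fin n) (x v : Euc n) (t : ℝ) :
    ∫ y : Euc n, ∑ j : Fin n, ∑ k : Fin n, Kten n i j k (x - y) t * v k * v j = 0 := by
  rw [integral_sub_left_eq_self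
    (fun z : Euc n => ∑ j : Fin n, ∑ k : Fin n, Kten n i j k z t * v k * v j) volume x]
  refine Euc.integral_eq_zero_of_odd fun z => ?_
  simp only [fun j k => Kten_odd n i j k t z, neg_mul, Finset.sum_neg_distrib]

/-- The heat kernel has unit mass. -/
lemma integral_heatKer (n : ℕ) (x : Euc n) {t : ℝ} (ht : 0 < t) :
    ∫ y : Euc n, heatKer n (x - y) t = 1 := by
  rw [integral_sub_left_eq_self (fun z : Euc n => heatKer n z t) volume x]
  have h := GaussianFourier.integral_rexp_neg_mul_sq_norm (V := Euc n)
    (b := (4 * t)⁻¹) (by positivity)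
  have hpos : 0 < 4 * π * t := by positivity
  have hexp (z : Euc n) : -‖z‖ ^ 2 / (4 * t) = -(4 * t)⁻¹ * ‖z‖ ^ 2 := by
    field_simp
  simp only [heatKer, hexp, integral_const_mul]
  rw [h, finrank_euclideanSpace_fin, show π / (4 * t)⁻¹ = 4 * π * t by field_simp,
    ← Real.rpow_add hpos, neg_div, neg_add_cancel, Real.rpow_zero]

/-- A spatially constant mild solution agrees at later times with its initial datum. -/
lemma IsMildNS.eq_initial_of_spatially_constant {n : ℕ} {T : ℝ} {u : Euc n → ℝ → Euc n}
    {b : ℝ → Euc n} (hu : IsMildNS n T 0 (fun x => u x T) u)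
    (hform : ∀ x : Euc n, ∀ t < (0 : ℝ), u x t = b t) {t : ℝ} (hT : T < t) (ht : t < 0) :
    b t = b T := by
  ext i
  have h := hu 0 t ⟨hT, ht⟩ i
  have hK : ∫ s in Set.Ioo T t, ∫ y : Euc n,
      ∑ j : Fin n, ∑ k : Fin n, Kten n i j k (0 - y) (t - s) * u y s k * u y s j = 0 := by
    refine setIntegral_eq_zero_of_forall_eq_zero fun s hs => ?_
    simp only [fun y => hform y s (hs.2.trans ht)]
    exact integral_Kten_const n i 0 (b s) (t - s)
  rw [hK] at h
  simpa only [hform _ t ht, hform _ T (hT.trans ht), integral_mul_const,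
    integral_heatKer n 0 (sub_pos.mpr hT), one_mul, sub_zero] using h

/-- Remark 6.2: a bounded ancient mild solution of the Navier–Stokes equations of the
form u(x,t) = b(t) is constant. -/
theorem ancient_mild_spatially_constant (n : ℕ) (hn : 2 ≤ n)
    (u : Euc n → ℝ → Euc n) (b : ℝ → Euc n)
    (hanc : IsAncientMild n u)
    (hform : ∀ x : Euc n, ∀ t < (0:ℝ), u x t = b t) :
    ∃ c : Euc n, ∀ t < (0:ℝ), b t = c := by
  obtain ⟨-, -, S, hS, hmild⟩ := hanc
  have key (t : ℝ) (ht : t < 0) : b t = b (-1) := by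
    obtain ⟨l, hl⟩ := (hS.eventually_lt_atBot (min t (-1))).exists
    have hl' := lt_min_iff.mp hl
    rw [(hmild l).2.eq_initial_of_spatially_constant hform hl'.1 ht,
      (hmild l).2.eq_initial_of_spatially_constant hform hl'.2 (by norm_num)]
  exact ⟨b (-1), key⟩

end
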